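/- Let λ be a Young diagram and let (P_1,…,P_D | Q_1,…,Q_D) be the Frobenius coordinates of λ⊔λ. Then for every 1 ≤ j ≤ D one has P_j = λ_{⌈j/2⌉} − j and Q_j = 2λ'_j − j; consequently Q_j ≡ j (mod 2) for all j, P_{2i−1} = P_{2i} + 1 whenever 2i ≤ D, and if D is odd then P_D = 0. -/

import Mathlib

/-- The doubled diagram `λ⊔λ = (λ_1,λ_1,λ_2,λ_2,…)`: row `i` (0-indexed) has length
`λ.rowLen (i/2)`. -/
def YoungDiagram.double (μ : YoungDiagram) : YoungDiagram where
  cells := μ.cells.biUnion fun c => {(2 * c.1, c.2), (2 * c.1 + 1, c.2)}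
  isLowerSet := by
    have hmem : ∀ i j : ℕ,
        ((i, j) ∈ μ.cells.biUnion fun c =>
          ({(2 * c.1, c.2), (2 * c.1 + 1, c.2)} : Finset (ℕ × ℕ))) ↔ (i / 2, j) ∈ μ.cells := by
      intro i j
      simp only [Finset.mem_biUnion, Finset.mem_insert, Finset.mem_singleton, Prod.mk.injEq]
      constructor
      · rintro ⟨c, hc, (⟨h1, h2⟩ | ⟨h1, h2⟩)⟩ <;> subst h2
        · have : i / 2 = c.1 := by omega
          rw [this]; exact hc
        · have : i / 2 = c.1 := by omega
          rw [this]; exact hc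
      · intro h
        refine ⟨(i / 2, j), h, ?_⟩
        rcases Nat.even_or_odd i with ⟨k, hk⟩ | ⟨k, hk⟩
        · left; exact ⟨by omega, rfl⟩
        · right; exact ⟨by omega, rfl⟩
    intro c1 c2 hle h1
    have h1' : (c1.1, c1.2) ∈ μ.cells.biUnion fun c =>
        ({(2 * c.1, c.2), (2 * c.1 + 1, c.2)} : Finset (ℕ × ℕ)) := h1
    rw [hmem] at h1'
    have hle' : ((c2.1 / 2, c2.2) : ℕ × ℕ) ≤ (c1.1 / 2, c1.2) :=
      ⟨Nat.div_le_div_right hle.1, hle.2⟩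
    have h2' : ((c2.1 / 2, c2.2) : ℕ × ℕ) ∈ (μ.cells : Set (ℕ × ℕ)) :=
      μ.isLowerSet hle' h1'
    exact (hmem c2.1 c2.2).mpr h2'

/-- The number `d` of diagonal boxes of a Young diagram. -/
def frobD (μ : YoungDiagram) : ℕ := (μ.cells.filter fun c => c.1 = c.2).card

/-- Frobenius coordinate `P_{i+1} = μ_{i+1} − (i+1)` (0-indexed `i`). -/
def frobP (μ : YoungDiagram) (i : ℕ) : ℕ := μ.rowLen i - (i + 1)

/-- Frobenius coordinate `Q_{i+1} = μ'_{i+1} − (i+1)` (0-indexed `i`). -/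
def frobQ (μ : YoungDiagram) (i : ℕ) : ℕ := μ.colLen i - (i + 1)

theorem YoungDiagram.mem_double {μ : YoungDiagram} {i j : ℕ} :
    (i, j) ∈ μ.double ↔ (i / 2, j) ∈ μ := by
  rw [← YoungDiagram.mem_cells, ← YoungDiagram.mem_cells]
  simp only [YoungDiagram.double, Finset.mem_biUnion, Finset.mem_insert, Finset.mem_singleton,
    Prod.mk.injEq]
  constructor
  · rintro ⟨⟨a, b⟩, hc, h⟩
    obtain rfl : i / 2 = a := by grind
    obtain rfl : j = b := by grind
    exact hc
  · exact fun h => ⟨(i / 2, j), h, by grind⟩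

theorem YoungDiagram.rowLen_double (μ : YoungDiagram) (i : ℕ) :
    μ.double.rowLen i = μ.rowLen (i / 2) :=
  eq_of_forall_lt_iff fun j => by
    rw [← YoungDiagram.mem_iff_lt_rowLen, ← YoungDiagram.mem_iff_lt_rowLen,
      YoungDiagram.mem_double]

theorem YoungDiagram.colLen_double (μ : YoungDiagram) (j : ℕ) :
    μ.double.colLen j = 2 * μ.colLen j :=
  eq_of_forall_lt_iff fun i => by
    rw [← YoungDiagram.mem_iff_lt_colLen, YoungDiagram.mem_double,
      YoungDiagram.mem_iff_lt_colLen]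
    omega

/-- The diagonal boxes of a Young diagram are `(0, 0), …, (d - 1, d - 1)`. -/
theorem lt_frobD_iff {μ : YoungDiagram} {j : ℕ} : j < frobD μ ↔ (j, j) ∈ μ := by
  have hex : ∃ n, (n, n) ∉ μ := by
    obtain ⟨n, hn⟩ := μ.exists_notMem_row 0
    exact ⟨n, fun h => hn (μ.up_left_mem (Nat.zero_le n) le_rfl h)⟩
  have hfind : ∀ n, n < Nat.find hex ↔ (n, n) ∈ μ := fun n => by
    refine ⟨fun h => not_not.mp (Nat.find_min hex h), fun h => ?_⟩
    by_contra! hle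
    exact Nat.find_spec hex (μ.up_left_mem hle hle h)
  have hdiag : μ.cells.filter (fun c => c.1 = c.2) =
      (Finset.range (Nat.find hex)).image fun n => (n, n) := by
    ext ⟨a, b⟩
    simp only [Finset.mem_filter, YoungDiagram.mem_cells, Finset.mem_image, Finset.mem_range,
      hfind, Prod.mk.injEq]
    constructor
    · rintro ⟨h, rfl⟩
      exact ⟨a, h, rfl, rfl⟩
    · rintro ⟨n, h, rfl, rfl⟩
      exact ⟨h, rfl⟩
  rw [frobD, hdiag, Finset.card_image_of_injective _ fun a b h => congrArg Prod.fst h,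
    Finset.card_range, hfind]

/-- Let `(P_1,…,P_D | Q_1,…,Q_D)` be the Frobenius coordinates of `λ⊔λ` (here 0-indexed:
`frobP lam.double j = P_{j+1}`, etc.). Then `P_j = λ_{⌈j/2⌉} − j` and `Q_j = 2λ'_j − j`
(1-indexed); consequently `Q_j ≡ j (mod 2)`, `P_{2i−1} = P_{2i} + 1` whenever `2i ≤ D`,
and if `D` is odd then `P_D = 0`. -/
theorem frobenius_coords_double (lam : YoungDiagram) :
    (∀ j : ℕ, j < frobD lam.double →
      ((frobP lam.double j : ℤ) = (lam.rowLen (j / 2) : ℤ) - (j + 1) ∧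
        (frobQ lam.double j : ℤ) = 2 * (lam.colLen j : ℤ) - (j + 1))) ∧
    (∀ j : ℕ, j < frobD lam.double → frobQ lam.double j % 2 = (j + 1) % 2) ∧
    (∀ k : ℕ, 2 * k + 1 < frobD lam.double →
      frobP lam.double (2 * k) = frobP lam.double (2 * k + 1) + 1) ∧
    (Odd (frobD lam.double) → frobP lam.double (frobD lam.double - 1) = 0) := by
  have hrow : ∀ j, j < frobD lam.double ↔ j < lam.rowLen (j / 2) := fun j => by
    rw [lt_frobD_iff, YoungDiagram.mem_iff_lt_rowLen, YoungDiagram.rowLen_double]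
  have hcol : ∀ j, j < frobD lam.double ↔ j < 2 * lam.colLen j := fun j => by
    rw [lt_frobD_iff, YoungDiagram.mem_iff_lt_colLen, YoungDiagram.colLen_double]
  simp only [frobP, frobQ, YoungDiagram.rowLen_double, YoungDiagram.colLen_double]
  refine ⟨fun j hj => ?_, fun j hj => ?_, fun k hk => ?_, ?_⟩
  · have := (hrow j).mp hj
    have := (hcol j).mp hj
    omega
  · have := (hcol j).mp hj
    omega
  · have := (hrow _).mp hk
    rw [show (2 * k + 1) / 2 = k by omega] at this ⊢
    rw [show 2 * k / 2 = k by omega]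
    omega
  · rintro ⟨k, hk⟩
    have := (hrow (2 * k + 1)).not.mp (by omega)
    rw [show (2 * k + 1) / 2 = k by omega] at this
    rw [hk, show 2 * k + 1 - 1 = 2 * k by omega, show 2 * k / 2 = k by omega]
    omega
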